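/- Let n ≥ 2 and l ≥ 1. Let y₁, …, y_l : ℝ → ℝⁿ be continuous with |yᵢ(t)| = 1 for all i, t, and set Π_{yᵢ(t)} := I − yᵢ(t)yᵢ(t)ᵀ. Let Q₁₁, …, Q_ll : ℝ → Matrix(n,n,ℝ) be continuous symmetric with Qᵢᵢ(t) ≥ ε_q·I for some ε_q > 0 and all t. Let A be the constant 2n×2n block matrix [[0_{n×n}, I_n], [0_{n×n}, 0_{n×n}]], let Δ(t) := Σᵢ Π_{yᵢ(t)}·Qᵢᵢ(t)·Π_{yᵢ(t)}, and let G(t) be the 2n×2n block matrix [[Δ(t), 0], [0, 0]]. If there exist δ > 0 and ε > 0 such that (1/δ)∫_t^{t+δ} Σᵢ Π_{yᵢ(s)} ds ≥ ε·I_n for all t ≥ 0, then there exist δ̄ > 0 and μ > 0 such that (1/δ̄)∫_t^{t+δ̄} exp(A(s−t))ᵀ · G(s) · exp(A(s−t)) ds ≥ μ·I_{2n} for all t ≥ 0. -/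

import Mathlib

open Matrix MeasureTheory

/-- Entrywise integral of a matrix-valued function. -/
noncomputable def matInt {ι κ : Type*} (f : ℝ → Matrix ι κ ℝ) (a b : ℝ) : Matrix ι κ ℝ :=
  Matrix.of fun i j => ∫ s in a..b, f s i j

noncomputable def ppf {n : ℕ} (u x : Fin n → ℝ) : ℝ := x ⬝ᵥ x - (u ⬝ᵥ x) ^ 2

theorem dp_self_nonneg {ι : Type*} [Fintype ι] (x : ι → ℝ) : 0 ≤ x ⬝ᵥ x :=
  Finset.sum_nonneg fun _ _ => mul_self_nonneg _

theorem ppf_nonneg {n : ℕ} {u : Fin n → ℝ} (hu : u ⬝ᵥ u = 1) (x : Fin n → ℝ) :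
    0 ≤ ppf u x := by
  have h := dp_self_nonneg (x - (u ⬝ᵥ x) • u)
  simp only [sub_dotProduct, dotProduct_sub, smul_dotProduct, dotProduct_smul, smul_eq_mul, hu,
    dotProduct_comm x u] at h
  unfold ppf
  nlinarith

theorem ppf_le {n : ℕ} (u x : Fin n → ℝ) : ppf u x ≤ x ⬝ᵥ x := by
  unfold ppf
  nlinarith [sq_nonneg (u ⬝ᵥ x)]

theorem ppf_add_smul {n : ℕ} {u : Fin n → ℝ} (hu : u ⬝ᵥ u = 1) (x b : Fin n → ℝ) (r : ℝ) :
    1 / 2 * ppf u x - r ^ 2 * ppf u b ≤ ppf u (x + r • b) := by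
  have h := ppf_nonneg hu (x + (2 * r) • b)
  unfold ppf at *
  simp only [add_dotProduct, dotProduct_add, smul_dotProduct, dotProduct_smul, smul_eq_mul,
    dotProduct_comm b x] at *
  nlinarith

theorem proj_mulVec {n : ℕ} (u x : Fin n → ℝ) :
    ((1 : Matrix (Fin n) (Fin n) ℝ) - vecMulVec u u) *ᵥ x = x - (u ⬝ᵥ x) • u := by
  rw [sub_mulVec, one_mulVec]
  congr 1
  ext i
  simp only [mulVec, vecMulVec_apply, dotProduct, Pi.smul_apply, smul_eq_mul, Finset.sum_mul]
  exact Finset.sum_congr rfl fun j _ => by ring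

theorem proj_quad {n : ℕ} (u x : Fin n → ℝ) :
    x ⬝ᵥ (((1 : Matrix (Fin n) (Fin n) ℝ) - vecMulVec u u) *ᵥ x) = ppf u x := by
  rw [proj_mulVec, dotProduct_sub, dotProduct_smul, dotProduct_comm x u, ppf, smul_eq_mul]
  ring

theorem proj_symm {n : ℕ} (u : Fin n → ℝ) :
    ((1 : Matrix (Fin n) (Fin n) ℝ) - vecMulVec u u)ᵀ = 1 - vecMulVec u u := by
  rw [transpose_sub, transpose_one]
  congr 1
  ext i j
  simp [vecMulVec_apply, mul_comm]

theorem quad_conj {ι : Type*} [Fintype ι] (B M : Matrix ι ι ℝ) (v : ι → ℝ) :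
    v ⬝ᵥ ((Bᵀ * M * B) *ᵥ v) = (B *ᵥ v) ⬝ᵥ (M *ᵥ (B *ᵥ v)) := by
  rw [← mulVec_mulVec, ← mulVec_mulVec, dotProduct_mulVec, vecMul_transpose]

theorem projQ_quad {n : ℕ} {u : Fin n → ℝ} (hu : u ⬝ᵥ u = 1) (x : Fin n → ℝ)
    (Q : Matrix (Fin n) (Fin n) ℝ) (e : ℝ)
    (hQ : (Q - e • (1 : Matrix (Fin n) (Fin n) ℝ)).PosSemidef) :
    e * ppf u x ≤ x ⬝ᵥ (((1 - vecMulVec u u) * Q * (1 - vecMulVec u u)) *ᵥ x) := by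
  have h1 := quad_conj (1 - vecMulVec u u) Q x
  rw [proj_symm] at h1
  rw [h1]
  have h2 := hQ.dotProduct_mulVec_nonneg ((1 - vecMulVec u u) *ᵥ x)
  rw [star_trivial, sub_mulVec Q, smul_mulVec, one_mulVec, dotProduct_sub, dotProduct_smul,
    smul_eq_mul] at h2
  have h3 : ((1 - vecMulVec u u) *ᵥ x) ⬝ᵥ ((1 - vecMulVec u u) *ᵥ x) = ppf u x := by
    rw [proj_mulVec]
    simp only [sub_dotProduct, dotProduct_sub, smul_dotProduct, dotProduct_smul, smul_eq_mul, hu,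
      dotProduct_comm x u, ppf]
    ring
  rw [h3] at h2
  linarith

theorem matInt_quad {ι : Type*} [Fintype ι] (f : ℝ → Matrix ι ι ℝ) (hf : Continuous f)
    (a b : ℝ) (v : ι → ℝ) :
    v ⬝ᵥ (matInt f a b *ᵥ v) = ∫ s in a..b, v ⬝ᵥ (f s *ᵥ v) := by
  have hc : ∀ i j, Continuous fun s => f s i j := fun i j => hf.matrix_elem i j
  simp only [matInt, dotProduct, mulVec, of_apply]
  rw [intervalIntegral.integral_finsetSum]
  · refine Finset.sum_congr rfl fun i _ => ?_
    rw [intervalIntegral.integral_const_mul, intervalIntegral.integral_finsetSum]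
    · congr 1
      refine Finset.sum_congr rfl fun j _ => ?_
      rw [intervalIntegral.integral_mul_const]
    · intro j _
      exact ((hc i j).mul continuous_const).intervalIntegrable _ _
  · intro i _
    refine Continuous.intervalIntegrable ?_ _ _
    exact continuous_const.mul (continuous_finsetSum _ fun j _ => (hc i j).mul continuous_const)

theorem exp_nil {n : ℕ} (r : ℝ) :
    NormedSpace.exp (r • (Matrix.fromBlocks 0 1 0 0 : Matrix (Fin n ⊕ Fin n) (Fin n ⊕ Fin n) ℝ))
      = Matrix.fromBlocks 1 (r • 1) 0 1 := by
  have hsq : (r • (Matrix.fromBlocks 0 1 0 0 : Matrix (Fin n ⊕ Fin n) (Fin n ⊕ Fin n) ℝ)) ^ 2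
      = 0 := by
    rw [sq, fromBlocks_smul, fromBlocks_multiply]
    simp
  rw [NormedSpace.exp_eq_tsum ℝ]
  simp only
  rw [tsum_eq_sum (s := Finset.range 2)]
  · simp only [Finset.sum_range_succ, Finset.sum_range_zero]
    simp [fromBlocks_smul, ← fromBlocks_one, fromBlocks_add]
  · intro b hb
    have : 2 ≤ b := by simpa [Nat.succ_le_iff] using hb
    rw [pow_eq_zero_of_le this hsq, smul_zero]

/-- window estimate -/
theorem window_est {n l : ℕ} (y : Fin l → ℝ → Fin n → ℝ)
    (hycont : ∀ i, Continuous (y i)) (hyunit : ∀ i t, y i t ⬝ᵥ y i t = 1)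
    (δ ε : ℝ) (hδ : 0 < δ) (t : ℝ)
    (h : ∀ x, δ * ε * (x ⬝ᵥ x) ≤ ∫ s in t..(t+δ), ∑ i, ppf (y i s) x)
    (x b : Fin n → ℝ) :
    δ * (1 / 2 * ε * (x ⬝ᵥ x) - δ ^ 2 * l * (b ⬝ᵥ b)) ≤
      ∫ s in t..(t+δ), ∑ i, ppf (y i s) (x + (s - t) • b) := by
  have hc1 : Continuous fun s => ∑ i, ppf (y i s) x := by
    unfold ppf; fun_prop
  have hc2 : Continuous fun s => ∑ i, ppf (y i s) (x + (s - t) • b) := by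
    unfold ppf; fun_prop
  have hle : t ≤ t + δ := by linarith
  have key : ∫ s in t..(t+δ), (1 / 2 * (∑ i, ppf (y i s) x) - δ ^ 2 * l * (b ⬝ᵥ b)) ≤
      ∫ s in t..(t+δ), ∑ i, ppf (y i s) (x + (s - t) • b) := by
    apply intervalIntegral.integral_mono_on hle
    · exact Continuous.intervalIntegrable (by fun_prop) _ _
    · exact hc2.intervalIntegrable _ _
    · intro s hs
      have h1 : ∀ i, 1 / 2 * ppf (y i s) x - δ ^ 2 * (b ⬝ᵥ b) ≤
          ppf (y i s) (x + (s - t) • b) := by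
        intro i
        refine le_trans ?_ (ppf_add_smul (hyunit i s) x b (s - t))
        have h2 : (s - t) ^ 2 ≤ δ ^ 2 := by
          apply pow_le_pow_left₀ <;> linarith [hs.1, hs.2]
        have h3 := mul_le_mul h2 (ppf_le (y i s) b) (ppf_nonneg (hyunit i s) b) (sq_nonneg δ)
        linarith
      have h4 := Finset.sum_le_sum fun i (_ : i ∈ Finset.univ) => h1 i
      rw [Finset.sum_sub_distrib, ← Finset.mul_sum] at h4
      simp at h4
      linarith
  refine le_trans ?_ key
  rw [intervalIntegral.integral_sub, intervalIntegral.integral_const_mul]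
  · simp
    nlinarith [h x]
  · exact Continuous.intervalIntegrable (by fun_prop) _ _
  · simp

/-- Observability Grammian positivity for the multiple-direction, biased-velocity
estimation problem: if `(1/δ)∫ Σᵢ Π_{yᵢ(s)} ds ≥ ε I`, then the Riccati observability
Grammian built from `A = [[0, I],[0, 0]]` and `G(t) = [[Δ(t), 0],[0, 0]]`,
`Δ(t) = Σᵢ Π_{yᵢ(t)} Qᵢᵢ(t) Π_{yᵢ(t)}`, is uniformly positive definite. -/
theorem pe_multiple_direction_biased_grammian
    (n l : ℕ) (hn : 2 ≤ n) (hl : 1 ≤ l)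
    (y : Fin l → ℝ → Fin n → ℝ)
    (hycont : ∀ i, Continuous (y i)) (hyunit : ∀ i t, y i t ⬝ᵥ y i t = 1)
    (Pr : Fin l → ℝ → Matrix (Fin n) (Fin n) ℝ)
    (hPr : Pr = fun i t => (1 : Matrix (Fin n) (Fin n) ℝ) - vecMulVec (y i t) (y i t))
    (Q : Fin l → ℝ → Matrix (Fin n) (Fin n) ℝ)
    (hQcont : ∀ i, Continuous (Q i)) (hQsymm : ∀ i t, (Q i t).IsSymm)
    (ε_q : ℝ) (hεq : 0 < ε_q)
    (hQ : ∀ i t, (Q i t - ε_q • (1 : Matrix (Fin n) (Fin n) ℝ)).PosSemidef)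
    (A : Matrix (Fin n ⊕ Fin n) (Fin n ⊕ Fin n) ℝ)
    (hA : A = Matrix.fromBlocks 0 1 0 0)
    (Δ : ℝ → Matrix (Fin n) (Fin n) ℝ)
    (hΔ : Δ = fun t => ∑ i, Pr i t * Q i t * Pr i t)
    (G : ℝ → Matrix (Fin n ⊕ Fin n) (Fin n ⊕ Fin n) ℝ)
    (hG : G = fun t => Matrix.fromBlocks (Δ t) 0 0 0)
    (δ ε : ℝ) (hδ : 0 < δ) (hε : 0 < ε)
    (hpe : ∀ t, 0 ≤ t →
      ((1 / δ) • matInt (fun s => ∑ i, Pr i s) t (t + δ)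
        - ε • (1 : Matrix (Fin n) (Fin n) ℝ)).PosSemidef) :
    ∃ δ' > (0 : ℝ), ∃ μ > (0 : ℝ), ∀ t, 0 ≤ t →
      ((1 / δ') • matInt (fun s =>
          (NormedSpace.exp ((s - t) • A))ᵀ * G s * NormedSpace.exp ((s - t) • A))
          t (t + δ')
        - μ • (1 : Matrix (Fin n ⊕ Fin n) (Fin n ⊕ Fin n) ℝ)).PosSemidef := by
  subst hPr hA hΔ hG
  have hΔc : Continuous fun s => ∑ i, (1 - vecMulVec (y i s) (y i s)) * Q i s *
      (1 - vecMulVec (y i s) (y i s)) := by fun_prop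
  have hP : ∀ t, 0 ≤ t → ∀ x : Fin n → ℝ,
      δ * ε * (x ⬝ᵥ x) ≤ ∫ s in t..(t+δ), ∑ i, ppf (y i s) x := by
    intro t ht x
    have h := (hpe t ht).dotProduct_mulVec_nonneg x
    rw [star_trivial, sub_mulVec, smul_mulVec, smul_mulVec, one_mulVec, dotProduct_sub,
      dotProduct_smul, dotProduct_smul, smul_eq_mul, smul_eq_mul,
      matInt_quad _ (by fun_prop)] at h
    simp only [sum_mulVec, dotProduct_sum, proj_quad] at h
    have h2 := mul_nonneg hδ.le h
    rw [mul_sub, ← mul_assoc, mul_one_div_cancel hδ.ne', one_mul] at h2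
    linarith
  obtain ⟨k, hk⟩ := exists_nat_gt (16 * (l : ℝ) / ε + 1)
  have hl0 : (0 : ℝ) ≤ l := Nat.cast_nonneg l
  have hk1 : (1 : ℝ) ≤ k := by
    have : 0 ≤ 16 * (l : ℝ) / ε := by positivity
    linarith
  have hk2 : 16 * (l : ℝ) ≤ ε * (k : ℝ) ^ 2 := by
    have h1 : 16 * (l : ℝ) / ε ≤ k := by linarith
    rw [div_le_iff₀ hε] at h1
    nlinarith
  clear hk
  have hm : 0 < min 1 ((k : ℝ) ^ 2 * δ ^ 2 / 2) := by positivity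
  set m := min 1 ((k : ℝ) ^ 2 * δ ^ 2 / 2) with hmdef
  refine ⟨(k + 1) * δ, by positivity, ε_q * ε * m / (8 * (k + 1)), by positivity, ?_⟩
  intro t ht
  simp only [exp_nil]
  have hFc : Continuous fun s => (fromBlocks 1 ((s - t) • 1) 0 1 :
      Matrix (Fin n ⊕ Fin n) (Fin n ⊕ Fin n) ℝ)ᵀ *
      fromBlocks (∑ i, (1 - vecMulVec (y i s) (y i s)) * Q i s *
      (1 - vecMulVec (y i s) (y i s))) 0 0 0 * fromBlocks 1 ((s - t) • 1) 0 1 := by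
    have h1 : Continuous fun s : ℝ => (fromBlocks 1 ((s - t) • 1) 0 1 :
      Matrix (Fin n ⊕ Fin n) (Fin n ⊕ Fin n) ℝ) :=
      Continuous.matrix_fromBlocks (by fun_prop) (by fun_prop) (by fun_prop) (by fun_prop)
    have h2 := Continuous.matrix_fromBlocks hΔc (continuous_const (y := (0 : Matrix (Fin n) (Fin n) ℝ)))
      (continuous_const (y := (0 : Matrix (Fin n) (Fin n) ℝ))) (continuous_const (y := (0 : Matrix (Fin n) (Fin n) ℝ)))
    exact (h1.matrix_transpose.matrix_mul h2).matrix_mul h1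
  apply PosSemidef.of_dotProduct_mulVec_nonneg
  · have hsym : ∀ s, ((fromBlocks 1 ((s - t) • 1) 0 1 :
      Matrix (Fin n ⊕ Fin n) (Fin n ⊕ Fin n) ℝ)ᵀ *
      fromBlocks (∑ i, (1 - vecMulVec (y i s) (y i s)) * Q i s *
      (1 - vecMulVec (y i s) (y i s))) 0 0 0 * fromBlocks 1 ((s - t) • 1) 0 1).IsSymm := by
      intro s
      rw [IsSymm, transpose_mul, transpose_mul, transpose_transpose, mul_assoc]
      congr 2
      rw [fromBlocks_transpose, transpose_sum]
      simp only [transpose_mul, proj_symm, (hQsymm _ s).eq, transpose_zero, mul_assoc]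
    ext i j
    have hij : ∀ s, _ := fun s => (hsym s).apply i j
    simp only [conjTranspose_apply, Matrix.sub_apply, Matrix.smul_apply, matInt, of_apply, star_trivial, hij]
    congr 2
    exact congrFun (congrFun (transpose_one) i) j
  · intro v
    rw [star_trivial, sub_mulVec, smul_mulVec, smul_mulVec, one_mulVec, dotProduct_sub,
      dotProduct_smul, dotProduct_smul, smul_eq_mul, smul_eq_mul, matInt_quad _ hFc]
    obtain ⟨a, b, rfl⟩ : ∃ a b : Fin n → ℝ, v = Sum.elim a b :=
      ⟨v ∘ Sum.inl, v ∘ Sum.inr, (Sum.elim_comp_inl_inr v).symm⟩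
    rw [sumElim_dotProduct_sumElim]
    have hquad : ∀ s, ε_q * (∑ i, ppf (y i s) (a + (s - t) • b)) ≤
        Sum.elim a b ⬝ᵥ (((fromBlocks 1 ((s - t) • 1) 0 1 :
      Matrix (Fin n ⊕ Fin n) (Fin n ⊕ Fin n) ℝ)ᵀ *
      fromBlocks (∑ i, (1 - vecMulVec (y i s) (y i s)) * Q i s *
      (1 - vecMulVec (y i s) (y i s))) 0 0 0 * fromBlocks 1 ((s - t) • 1) 0 1) *ᵥ
        Sum.elim a b) := by
      intro s
      rw [quad_conj]
      simp only [fromBlocks_mulVec, Sum.elim_comp_inl, Sum.elim_comp_inr, one_mulVec,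
        smul_mulVec, zero_mulVec, sumElim_dotProduct_sumElim, add_zero, zero_add, dotProduct_zero,
        sum_mulVec, dotProduct_sum]
      rw [Finset.mul_sum]
      exact Finset.sum_le_sum fun i _ => projQ_quad (hyunit i s) _ _ _ (hQ i s)
    have hWc : Continuous fun s => ∑ i, ppf (y i s) (a + (s - t) • b) := by
      unfold ppf; fun_prop
    have hI := intervalIntegral.integral_mono (μ := volume) (a := t) (b := t + (k + 1) * δ)
      (by nlinarith) ((hWc.const_smul ε_q).intervalIntegrable _ _)
      ((Continuous.dotProduct (continuous_const (y := Sum.elim a b))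
        (hFc.matrix_mulVec (continuous_const (y := Sum.elim a b)))).intervalIntegrable _ _) hquad
    simp only [Pi.smul_apply, smul_eq_mul] at hI
    rw [intervalIntegral.integral_const_mul] at hI
    have hw0 := window_est y hycont hyunit δ ε hδ t (hP t ht) a b
    have hw1 := window_est y hycont hyunit δ ε hδ (t + k * δ) (hP _ (by positivity))
      (a + (k * δ) • b) b
    have hsplit : (∫ s in t..(t + δ), ∑ i, ppf (y i s) (a + (s - t) • b)) +
        (∫ s in (t + k * δ)..(t + k * δ + δ), ∑ i, ppf (y i s) (a + (s - t) • b)) ≤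
        ∫ s in t..(t + (k + 1) * δ), ∑ i, ppf (y i s) (a + (s - t) • b) := by
      have e1 := intervalIntegral.integral_add_adjacent_intervals (μ := volume)
        (hWc.intervalIntegrable t (t + δ)) (hWc.intervalIntegrable (t + δ) (t + k * δ))
      have e2 := intervalIntegral.integral_add_adjacent_intervals (μ := volume)
        (hWc.intervalIntegrable t (t + k * δ))
        (hWc.intervalIntegrable (t + k * δ) (t + k * δ + δ))
      have e3 : 0 ≤ ∫ s in (t + δ)..(t + k * δ), ∑ i, ppf (y i s) (a + (s - t) • b) :=
        intervalIntegral.integral_nonneg (by nlinarith) fun s _ =>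
          Finset.sum_nonneg fun i _ => ppf_nonneg (hyunit i s) _
      have e4 : t + (k + 1) * δ = t + k * δ + δ := by ring
      rw [e4]
      linarith
    have hre : ∀ s, a + ((k : ℝ) * δ) • b + (s - (t + k * δ)) • b = a + (s - t) • b := by
      intro s
      rw [add_assoc, ← add_smul]
      congr 2
      ring
    simp only [hre] at hw1
    have hX := dp_self_nonneg (a + (k * δ) • b)
    have hX2 := dp_self_nonneg (a + (a + (k * δ) • b))
    have ha := dp_self_nonneg a
    have hb := dp_self_nonneg b
    have hS : (k : ℝ) ^ 2 * δ ^ 2 / 2 * (b ⬝ᵥ b) ≤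
        a ⬝ᵥ a + (a + (k * δ) • b) ⬝ᵥ (a + (k * δ) • b) := by
      simp only [add_dotProduct, dotProduct_add, smul_dotProduct, dotProduct_smul, smul_eq_mul,
        dotProduct_comm b a] at *
      nlinarith
    set J := ∫ s in t..(t + (k + 1) * δ), ∑ i, ppf (y i s) (a + (s - t) • b)
    set X := (a + ((k : ℝ) * δ) • b) ⬝ᵥ (a + ((k : ℝ) * δ) • b)
    set α := a ⬝ᵥ a
    set β := b ⬝ᵥ b
    have hJ : δ * (ε / 4 * (α + X)) ≤ J := by
      refine le_trans ?_ (le_trans (add_le_add hw0 hw1) hsplit)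
      rw [← mul_add]
      apply mul_le_mul_of_nonneg_left _ hδ.le
      have h1 := mul_le_mul_of_nonneg_left hS hε.le
      have h2 := mul_le_mul_of_nonneg_right hk2 (mul_nonneg (sq_nonneg δ) hb)
      linarith
    have hm1 : m * α ≤ α + X := by
      have := mul_le_mul_of_nonneg_right (min_le_left 1 ((k : ℝ) ^ 2 * δ ^ 2 / 2)) ha
      linarith
    have hm2 : m * β ≤ α + X :=
      (mul_le_mul_of_nonneg_right (min_le_right 1 ((k : ℝ) ^ 2 * δ ^ 2 / 2)) hb).trans hS
    have hJ2 : δ * ε / 8 * (m * (α + β)) ≤ J := by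
      refine le_trans ?_ hJ
      have := mul_le_mul_of_nonneg_left (add_le_add hm1 hm2) (by positivity : 0 ≤ δ * ε / 8)
      linarith
    have hfin := (mul_le_mul_of_nonneg_left hJ2 hεq.le).trans hI
    rw [sub_nonneg]
    refine le_trans (le_of_eq ?_) (mul_le_mul_of_nonneg_left hfin (by positivity))
    field_simp
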